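/- arXiv:2401.05045 — 2 statements merged into one kernel-verified Lean document; each statement's English description precedes it below -/
import Mathlib

section
/- Let λ = 0 and A > e, and let P_{X*} be a capacity-achieving input distribution of the amplitude-constrained discrete-time Poisson channel. Then the support of P_{X*} is finite and |supp(P_{X*})| ≤ ⌊3 + log(1 + A e^{2eA+1}(log A + √(2(log A − 1))))⌋. -/
open MeasureTheory Real Set

noncomputable section

/-- Poisson transition pmf with dark current `lam`:
`P_{Y|X}(y|x) = (x+lam)^y e^{-(x+lam)} / y!` (with the convention `0^0 = 1`). -/
def channelPMF (lam x : ℝ) (y : ℕ) : ℝ :=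
  (x + lam) ^ y * Real.exp (-(x + lam)) / (Nat.factorial y)

/-- Output pmf induced by the input distribution `μ`. -/
def outputPMF (lam : ℝ) (μ : Measure ℝ) (y : ℕ) : ℝ :=
  ∫ x, channelPMF lam x y ∂μ

/-- Kullback–Leibler divergence between pmfs on `ℕ` (natural logarithm). -/
def klDiv (p q : ℕ → ℝ) : ℝ :=
  ∑' y, p y * Real.log (p y / q y)

/-- The function `i(x; μ) = D(P_{Y|X}(·|x) ‖ P_Y^μ)`. -/
def iFun (lam : ℝ) (μ : Measure ℝ) (x : ℝ) : ℝ :=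
  klDiv (channelPMF lam x) (outputPMF lam μ)

/-- Mutual information for input distribution `μ`. -/
def mutualInfo (lam : ℝ) (μ : Measure ℝ) : ℝ :=
  ∫ x, iFun lam μ x ∂μ

/-- Admissible input distributions: probability measures supported in `[0, A]`. -/
def IsInput (A : ℝ) (μ : Measure ℝ) : Prop :=
  IsProbabilityMeasure μ ∧ μ (Set.Icc 0 A)ᶜ = 0

/-- The capacity `C(A, lam)` of the amplitude-constrained Poisson channel. -/
def capacity (A lam : ℝ) : ℝ :=
  sSup (mutualInfo lam '' {μ : Measure ℝ | IsInput A μ})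

/-- A capacity-achieving input distribution. -/
def IsCapacityAchieving (A lam : ℝ) (μ : Measure ℝ) : Prop :=
  IsInput A μ ∧ mutualInfo lam μ = capacity A lam

/-- Topological support of a measure on `ℝ`. -/
def msupport (μ : Measure ℝ) : Set ℝ :=
  {x | ∀ U : Set ℝ, IsOpen U → x ∈ U → 0 < μ U}

/-! ### Counting zeros -/

/-- Rolle's theorem for several points: between consecutive points of a finite level set there is
a zero of the derivative. -/
theorem exists_finset_deriv_eq_zero {f f' : ℝ → ℝ} {s : Set ℝ} (hs : s.OrdConnected)
    (hf : ContinuousOn f s) (hf' : ∀ x ∈ interior s, HasDerivAt f (f' x) x) {c : ℝ}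
    (S : Finset ℝ) (hne : S.Nonempty) (hSs : (S : Set ℝ) ⊆ s) (hSc : ∀ x ∈ S, f x = c) :
    ∃ T : Finset ℝ, T.card + 1 = S.card ∧ Disjoint T S ∧
      (∀ t ∈ T, t ∈ interior s ∧ f' t = 0 ∧ ∃ x ∈ S, t < x) := by
  classical
  induction S using Finset.induction_on_max with
  | empty => simp at hne
  | insert b S hb ih =>
    have hbS : b ∉ S := fun h => lt_irrefl b (hb b h)
    rcases S.eq_empty_or_nonempty with rfl | hS
    · exact ⟨∅, by simp⟩
    obtain ⟨T, hcard, hdisj, hT⟩ := ih hS (fun x hx => hSs (by simp_all))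
      (fun x hx => hSc x (by simp [hx]))
    set m := S.max' hS with hm
    have hmS : m ∈ S := S.max'_mem hS
    have hmb : m < b := hb m hmS
    have hsub : Icc m b ⊆ s := hs.out (hSs (by simp [hmS])) (hSs (by simp))
    have hsub' : Ioo m b ⊆ interior s := by
      rw [← interior_Icc]; exact interior_mono hsub
    obtain ⟨d, hd, hd0⟩ := exists_hasDerivAt_eq_zero hmb (hf.mono hsub)
      ((hSc m (by simp [hmS])).trans (hSc b (by simp)).symm) (fun x hx => hf' x (hsub' hx))
    have hTm : ∀ t ∈ T, t < m := fun t ht => by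
      obtain ⟨x, hx, htx⟩ := (hT t ht).2.2
      exact htx.trans_le (S.le_max' x hx)
    have hdT : d ∉ T := fun h => lt_asymm hd.1 (hTm d h)
    refine ⟨insert d T, ?_, ?_, ?_⟩
    · rw [Finset.card_insert_of_notMem hdT, Finset.card_insert_of_notMem hbS, hcard]
    · rw [Finset.disjoint_left] at hdisj ⊢
      intro t ht htS
      rcases Finset.mem_insert.1 ht with rfl | ht
      · rcases Finset.mem_insert.1 htS with h | h
        · exact hd.2.ne h
        · exact (S.le_max' t h).not_gt hd.1
      · rcases Finset.mem_insert.1 htS with h | h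
        · exact ((hTm t ht).trans hmb).ne h
        · exact hdisj ht h
    · intro t ht
      rcases Finset.mem_insert.1 ht with rfl | ht
      · exact ⟨hsub' hd, hd0, b, by simp, hd.2⟩
      · obtain ⟨h1, h2, x, hx, h3⟩ := hT t ht
        exact ⟨h1, h2, x, by simp [hx], h3⟩

/-- If `f` attains its maximum over `[a, b]` at `N ≥ 2` points, then `f''` has at least `2N - 4`
zeros in `(a, b)`: each interior maximum is a critical point in addition to those from Rolle. -/
theorem exists_finset_second_deriv_eq_zero {f f' f'' : ℝ → ℝ} {a b c : ℝ}
    (hf : ContinuousOn f (Icc a b)) (hf' : ∀ x ∈ Ioo a b, HasDerivAt f (f' x) x)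
    (hf'' : ∀ x ∈ Ioo a b, HasDerivAt f' (f'' x) x) (hle : ∀ x ∈ Icc a b, f x ≤ c)
    (S : Finset ℝ) (hS2 : 2 ≤ S.card) (hSs : (S : Set ℝ) ⊆ Icc a b) (hSc : ∀ x ∈ S, f x = c) :
    ∃ T : Finset ℝ, 2 * S.card ≤ T.card + 4 ∧ ∀ t ∈ T, t ∈ Ioo a b ∧ f'' t = 0 := by
  classical
  obtain ⟨T, hcard, hdisj, hT⟩ := exists_finset_deriv_eq_zero ordConnected_Icc hf
    (by simpa using hf') S (Finset.card_pos.1 (by omega)) hSs hSc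
  set U := (S.erase a).erase b with hU
  have hUcard : S.card ≤ U.card + 2 := by
    have h1 := Finset.pred_card_le_card_erase (s := S) (a := a)
    have h2 := Finset.pred_card_le_card_erase (s := S.erase a) (a := b)
    rw [← hU] at h2
    omega
  have hUS : ∀ u ∈ U, u ∈ S ∧ u ∈ Ioo a b := by
    intro u hu
    simp only [hU, Finset.mem_erase] at hu
    have := hSs hu.2.2
    exact ⟨hu.2.2, lt_of_le_of_ne this.1 (Ne.symm hu.2.1), lt_of_le_of_ne this.2 hu.1⟩
  have hTU : Disjoint T U := by
    rw [Finset.disjoint_left] at hdisj ⊢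
    exact fun t ht htU => hdisj ht (hUS t htU).1
  have hcrit : ∀ t ∈ T ∪ U, t ∈ Ioo a b ∧ f' t = 0 := by
    intro t ht
    rcases Finset.mem_union.1 ht with ht | ht
    · exact ⟨by simpa using (hT t ht).1, (hT t ht).2.1⟩
    · obtain ⟨h1, h2⟩ := hUS t ht
      refine ⟨h2, IsLocalMax.hasDerivAt_eq_zero ?_ (hf' t h2)⟩
      filter_upwards [Icc_mem_nhds h2.1 h2.2] with x hx
      rw [hSc t h1]; exact hle x hx
  have hc : (T ∪ U).card = T.card + U.card := Finset.card_union_of_disjoint hTU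
  obtain ⟨V, hV, -, hV'⟩ := exists_finset_deriv_eq_zero (f := f') (f' := f'') ordConnected_Ioo
    (fun x hx => (hf'' x hx).continuousAt.continuousWithinAt) (by simpa using hf'')
    (T ∪ U) (Finset.card_pos.1 (by omega)) (fun t ht => (hcrit t ht).1) (fun t ht => (hcrit t ht).2)
  exact ⟨V, by omega, fun t ht => ⟨by simpa using (hV' t ht).1, (hV' t ht).2.1⟩⟩

/-- Jensen's inequality for the zeros of an entire function at finitely many positive reals. -/
theorem norm_mul_prod_le_of_zeros {f : ℂ → ℂ} (hf : Differentiable ℂ f) {R M : ℝ} (hR : 0 < R)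
    (hM : ∀ z, ‖z‖ = R → ‖f z‖ ≤ M) (S : Finset ℝ) (hS : ∀ a ∈ S, 0 < a ∧ a < R)
    (hz : ∀ a ∈ S, f a = 0) : ‖f 0‖ * ∏ a ∈ S, (R / a) ≤ M := by
  classical
  induction S using Finset.induction_on generalizing f with
  | empty =>
    have := Complex.norm_le_of_forall_mem_frontier_norm_le (U := Metric.ball (0 : ℂ) R)
      Metric.isBounded_ball hf.diffContOnCl (C := M) (fun z hz => hM z ?_) (z := 0) ?_
    · simpa using this
    · simpa [frontier_ball _ hR.ne'] using hz
    · exact subset_closure (by simpa using hR)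
  | insert a S ha ih =>
    obtain ⟨ha0, haR⟩ := hS a (by simp)
    have hfa : f a = 0 := hz a (by simp)
    set g : ℂ → ℂ := fun z => dslope f a z * ((R ^ 2 - a * z) / R) with hg
    have hslope : ∀ z : ℂ, z ≠ a → dslope f a z = (z - a)⁻¹ * f z := fun z hza => by
      rw [dslope_of_ne _ hza, slope_def_module, hfa, sub_zero, smul_eq_mul]
    have hdiff : Differentiable ℂ g := by
      have : Differentiable ℂ (dslope f (a : ℂ)) := by
        rw [← differentiableOn_univ,
          Complex.differentiableOn_dslope Filter.univ_mem, differentiableOn_univ]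
        exact hf
      exact this.mul (by fun_prop)
    have hgM : ∀ z, ‖z‖ = R → ‖g z‖ ≤ M := fun z hzR => by
      have hza : z ≠ a := by
        rintro rfl
        simp only [Complex.norm_real, norm_eq_abs, abs_of_pos ha0] at hzR
        exact haR.ne hzR
      have hnum : ‖(R : ℂ) ^ 2 - a * z‖ = R * ‖z - a‖ := by
        have h1 : (R : ℂ) ^ 2 = z * (starRingEnd ℂ) z := by
          rw [Complex.mul_conj, Complex.normSq_eq_norm_sq, hzR]; push_cast; ring
        have h2 : (R : ℂ) ^ 2 - a * z = z * (starRingEnd ℂ) (z - a) := by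
          rw [h1, map_sub, Complex.conj_ofReal]; ring
        rw [h2, norm_mul, RCLike.norm_conj, hzR]
      have hpos : ‖z - a‖ ≠ 0 := norm_ne_zero_iff.2 (sub_ne_zero.2 hza)
      have : ‖g z‖ = ‖f z‖ := by
        simp only [hg, hslope z hza, norm_mul, norm_div, norm_inv, hnum, Complex.norm_real,
          norm_eq_abs, abs_of_pos hR]
        field_simp
      rw [this]; exact hM z hzR
    have hgz : ∀ b ∈ S, g b = 0 := fun b hb => by
      have hba : (b : ℂ) ≠ a := by
        norm_cast; rintro rfl; exact ha hb
      simp [hg, hslope b hba, hz b (by simp [hb])]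
    have := ih hdiff hgM (fun b hb => hS b (by simp [hb])) hgz
    have h0 : ‖g 0‖ = ‖f 0‖ * (R / a) := by
      have h0a : (0 : ℂ) ≠ a := by norm_cast; exact ha0.ne
      simp only [hg, hslope 0 h0a, norm_mul, norm_div, norm_inv, zero_sub, norm_neg, mul_zero,
        sub_zero, norm_pow, Complex.norm_real, norm_eq_abs, abs_of_pos hR, abs_of_pos ha0]
      field_simp
    rwa [Finset.prod_insert ha, ← mul_assoc, ← h0]

/-! ### Exponential generating functions -/

/-- Sequences growing at most like `2 ^ n`. -/
def GeomBounded (L : ℕ → ℝ) : Prop := ∃ c, ∀ n, |L n| ≤ c * 2 ^ n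

theorem GeomBounded.shift {L : ℕ → ℝ} (hL : GeomBounded L) : GeomBounded fun n => L (n + 1) := by
  obtain ⟨c, hc⟩ := hL
  exact ⟨c * 2, fun n => (hc (n + 1)).trans_eq (by ring)⟩

theorem GeomBounded.sub {L K : ℕ → ℝ} (hL : GeomBounded L) (hK : GeomBounded K) :
    GeomBounded fun n => L n - K n := by
  obtain ⟨c, hc⟩ := hL
  obtain ⟨d, hd⟩ := hK
  exact ⟨c + d, fun n => (abs_sub _ _).trans (by linarith [hc n, hd n])⟩

theorem geomBounded_of_abs_le_affine {L : ℕ → ℝ} {c d : ℝ} (hc : 0 ≤ c) (hd : 0 ≤ d)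
    (h : ∀ n, |L n| ≤ c + d * n) : GeomBounded L := by
  refine ⟨c + d, fun n => (h n).trans ?_⟩
  have h1 : (1 : ℝ) ≤ 2 ^ n := one_le_pow₀ (by norm_num)
  have h2 : (n : ℝ) ≤ 2 ^ n := by exact_mod_cast (Nat.lt_two_pow_self (n := n)).le
  nlinarith

/-- The exponential generating function of `L`. -/
def expGen (L : ℕ → ℝ) (z : ℂ) : ℂ := ∑' n : ℕ, z ^ n / n.factorial * L n

theorem norm_expGen_term_le {L : ℕ → ℝ} {c R : ℝ} (hL : ∀ n, |L n| ≤ c * 2 ^ n) {z : ℂ}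
    (hz : ‖z‖ ≤ R) (n : ℕ) : ‖z ^ n / n.factorial * L n‖ ≤ c * ((2 * R) ^ n / n.factorial) := by
  have hR : 0 ≤ R := (norm_nonneg z).trans hz
  rw [norm_mul, norm_div, norm_pow, Complex.norm_natCast, Complex.norm_real, norm_eq_abs]
  calc ‖z‖ ^ n / n.factorial * |L n| ≤ R ^ n / n.factorial * (c * 2 ^ n) := by
        gcongr; exact hL n
    _ = _ := by rw [mul_pow]; ring

theorem GeomBounded.summable_expGen {L : ℕ → ℝ} (hL : GeomBounded L) (z : ℂ) :
    Summable fun n : ℕ => z ^ n / n.factorial * L n := by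
  obtain ⟨c, hc⟩ := hL
  exact .of_norm_bounded ((Real.summable_pow_div_factorial (2 * ‖z‖)).mul_left c)
    (norm_expGen_term_le hc le_rfl)

theorem GeomBounded.hasDerivAt_expGen {L : ℕ → ℝ} (hL : GeomBounded L) (z : ℂ) :
    HasDerivAt (expGen L) (expGen (fun n => L (n + 1)) z) z := by
  obtain ⟨c, hc⟩ := id hL
  have hc0 : 0 ≤ c := by simpa using (abs_nonneg _).trans (hc 0)
  set R := ‖z‖ + 1 with hR
  have hR1 : 1 ≤ R := by simp [hR]
  have key := hasDerivAt_tsum_of_isPreconnected (t := Metric.ball (0 : ℂ) R) (y₀ := 0) (y := z)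
    (g := fun (n : ℕ) (z : ℂ) => z ^ n / n.factorial * L n)
    (g' := fun (n : ℕ) (z : ℂ) => n * z ^ (n - 1) / n.factorial * L n)
    (u := fun n => c * ((4 * R) ^ n / n.factorial))
    ((Real.summable_pow_div_factorial (4 * R)).mul_left c) Metric.isOpen_ball
    (convex_ball _ _).isPreconnected
    (fun n y _ => ((hasDerivAt_pow n y).div_const _).mul_const _) ?_
    (by simp; positivity) (hL.summable_expGen 0) (by simp [hR])
  · refine HasDerivAt.congr_deriv (f := expGen L) key ?_
    have hs : Summable fun n : ℕ => (n : ℂ) * z ^ (n - 1) / n.factorial * L n := by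
      rw [← summable_nat_add_iff 1]
      refine (hL.shift.summable_expGen z).congr fun n => ?_
      have : (n : ℂ) + 1 ≠ 0 := by exact_mod_cast n.succ_ne_zero
      rw [Nat.factorial_succ]; push_cast; field_simp
    rw [hs.tsum_eq_zero_add]
    simp only [Nat.cast_zero, zero_mul, zero_div, zero_add, expGen]
    refine tsum_congr fun n => ?_
    have : (n : ℂ) + 1 ≠ 0 := by exact_mod_cast n.succ_ne_zero
    rw [Nat.factorial_succ]; push_cast; field_simp
  · intro n y hy
    have hy' : ‖y‖ ≤ R := (mem_ball_zero_iff.1 hy).le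
    rw [norm_mul, norm_div, norm_mul, norm_pow, Complex.norm_natCast, Complex.norm_natCast,
      Complex.norm_real, norm_eq_abs]
    have h2 : (n : ℝ) ≤ 2 ^ n := by exact_mod_cast (Nat.lt_two_pow_self (n := n)).le
    have h3 : ‖y‖ ^ (n - 1) ≤ R ^ n :=
      (pow_le_pow_left₀ (norm_nonneg _) hy' _).trans (pow_le_pow_right₀ hR1 (Nat.sub_le _ _))
    calc n * ‖y‖ ^ (n - 1) / n.factorial * |L n|
        ≤ 2 ^ n * R ^ n / n.factorial * (c * 2 ^ n) := by gcongr; exact hc n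
      _ = _ := by rw [mul_pow, show (4 : ℝ) = 2 * 2 by norm_num, mul_pow]; ring

theorem norm_expGen_le {L : ℕ → ℝ} {K : ℝ} (hK : ∀ n, |L n| ≤ K) (z : ℂ) :
    ‖expGen L z‖ ≤ K * Real.exp ‖z‖ := by
  have h := (NormedSpace.expSeries_div_hasSum_exp (𝔸 := ℝ) ‖z‖).mul_left K
  rw [← Real.exp_eq_exp_ℝ] at h
  refine tsum_of_norm_bounded h fun n => ?_
  rw [norm_mul, norm_div, norm_pow, Complex.norm_natCast, Complex.norm_real, norm_eq_abs, mul_comm]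
  gcongr
  exact hK n

/-- The Poisson transform `e^{-z} ∑ L n z^n / n!`, an entire function. -/
def poissonTransform (L : ℕ → ℝ) (z : ℂ) : ℂ := Complex.exp (-z) * expGen L z

theorem GeomBounded.hasDerivAt_poissonTransform {L : ℕ → ℝ} (hL : GeomBounded L) (z : ℂ) :
    HasDerivAt (poissonTransform L) (poissonTransform (fun n => L (n + 1) - L n) z) z := by
  have h := ((hasDerivAt_neg z).cexp).mul (hL.hasDerivAt_expGen z)
  refine HasDerivAt.congr_deriv (f := poissonTransform L) h ?_
  have : expGen (fun n => L (n + 1) - L n) z = expGen (fun n => L (n + 1)) z - expGen L z := by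
    rw [expGen, expGen, expGen,
      ← (hL.shift.summable_expGen z).tsum_sub (hL.summable_expGen z)]
    exact tsum_congr fun n => by push_cast; ring
  rw [poissonTransform, this]; ring

theorem norm_poissonTransform_le {L : ℕ → ℝ} {K : ℝ} (hK : ∀ n, |L n| ≤ K) (z : ℂ) :
    ‖poissonTransform L z‖ ≤ K * Real.exp (2 * ‖z‖) := by
  have hK0 : 0 ≤ K := (abs_nonneg _).trans (hK 0)
  rw [poissonTransform, norm_mul, Complex.norm_exp, Complex.neg_re]
  have h1 : -z.re ≤ ‖z‖ := (neg_le_abs _).trans (Complex.abs_re_le_norm z)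
  calc Real.exp (-z.re) * ‖expGen L z‖ ≤ Real.exp ‖z‖ * (K * Real.exp ‖z‖) := by
        gcongr; exact norm_expGen_le hK z
    _ = _ := by rw [two_mul, Real.exp_add]; ring

/-- Zero count for `1 - z · poissonTransform L z` on `(0, A)`. -/
theorem card_zeros_le_log {L : ℕ → ℝ} {A K : ℝ} (hA : 0 < A) (hL : GeomBounded L)
    (hK : ∀ n, |L n| ≤ K) (S : Finset ℝ) (hS : ∀ a ∈ S, a ∈ Ioo 0 A)
    (hz : ∀ a ∈ S, 1 - (a : ℂ) * poissonTransform L a = 0) :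
    (S.card : ℝ) ≤ Real.log (1 + A * Real.exp (2 * Real.exp 1 * A + 1) * K) := by
  have hK0 : 0 ≤ K := (abs_nonneg _).trans (hK 0)
  have he : 1 < Real.exp 1 := by simp
  have hdiff : Differentiable ℂ fun z => 1 - z * poissonTransform L z := fun z =>
    (differentiableAt_id.mul (hL.hasDerivAt_poissonTransform z).differentiableAt).const_sub 1
  have h := norm_mul_prod_le_of_zeros hdiff (R := Real.exp 1 * A)
    (M := 1 + A * Real.exp (2 * Real.exp 1 * A + 1) * K) (by positivity) ?_ S
    (fun a ha => ⟨(hS a ha).1, (hS a ha).2.trans (by nlinarith)⟩) hz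
  · have hprod : Real.exp 1 ^ S.card ≤ ∏ a ∈ S, (Real.exp 1 * A / a) := by
      rw [← Finset.prod_const]
      refine Finset.prod_le_prod (fun _ _ => (Real.exp_pos 1).le) fun a ha => ?_
      obtain ⟨h1, h2⟩ := hS a ha
      rw [le_div_iff₀ h1]; gcongr
    rw [Real.le_log_iff_exp_le (by positivity), ← Real.exp_one_pow]
    simp only [zero_mul, sub_zero, norm_one, one_mul] at h
    exact hprod.trans h
  · intro z hzR
    calc ‖1 - z * poissonTransform L z‖ ≤ 1 + ‖z‖ * ‖poissonTransform L z‖ := by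
          simpa using norm_sub_le 1 (z * poissonTransform L z)
      _ ≤ 1 + Real.exp 1 * A * (K * Real.exp (2 * (Real.exp 1 * A))) := by
          rw [hzR]; gcongr; rw [← hzR]; exact norm_poissonTransform_le hK z
      _ = _ := by rw [Real.exp_add, ← mul_assoc 2]; ring

/-! ### Poisson averages -/

theorem channelPMF_zero_left (x : ℝ) (y : ℕ) :
    channelPMF 0 x y = x ^ y * Real.exp (-x) / y.factorial := by
  simp [channelPMF]

theorem channelPMF_zero_nonneg {x : ℝ} (hx : 0 ≤ x) (y : ℕ) : 0 ≤ channelPMF 0 x y := by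
  rw [channelPMF_zero_left]; positivity

/-- The mean of `L Y` for a Poisson variable `Y` of parameter `x`. -/
def poissonMean (L : ℕ → ℝ) (x : ℝ) : ℝ := ∑' y, channelPMF 0 x y * L y

theorem ofReal_channelPMF_mul (L : ℕ → ℝ) (x : ℝ) (y : ℕ) :
    ((channelPMF 0 x y * L y : ℝ) : ℂ) =
      Complex.exp (-(x : ℂ)) * ((x : ℂ) ^ y / y.factorial * L y) := by
  rw [channelPMF_zero_left]; push_cast; ring

theorem GeomBounded.hasSum_poissonMean {L : ℕ → ℝ} (hL : GeomBounded L) (x : ℝ) :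
    HasSum (fun y => channelPMF 0 x y * L y) (poissonMean L x) := by
  refine Summable.hasSum ?_
  rw [← Complex.summable_ofReal]
  simp only [ofReal_channelPMF_mul]
  exact (hL.summable_expGen x).mul_left _

theorem poissonTransform_ofReal (L : ℕ → ℝ) (x : ℝ) :
    poissonTransform L x = (poissonMean L x : ℂ) := by
  rw [poissonMean, Complex.ofReal_tsum, poissonTransform, expGen, ← tsum_mul_left]
  simp only [ofReal_channelPMF_mul]

theorem GeomBounded.hasDerivAt_poissonMean {L : ℕ → ℝ} (hL : GeomBounded L) (x : ℝ) :
    HasDerivAt (poissonMean L) (poissonMean (fun n => L (n + 1) - L n) x) x := by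
  simpa only [poissonTransform_ofReal, Complex.ofReal_re] using
    (hL.hasDerivAt_poissonTransform x).real_of_complex

theorem GeomBounded.continuous_poissonMean {L : ℕ → ℝ} (hL : GeomBounded L) :
    Continuous (poissonMean L) :=
  continuous_iff_continuousAt.2 fun x => (hL.hasDerivAt_poissonMean x).continuousAt

theorem hasSum_channelPMF (x : ℝ) : HasSum (channelPMF 0 x) 1 := by
  have h := (NormedSpace.expSeries_div_hasSum_exp (𝔸 := ℝ) x).mul_left (Real.exp (-x))
  rw [← Real.exp_eq_exp_ℝ, ← Real.exp_add, neg_add_cancel, Real.exp_zero] at h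
  refine (congrArg (HasSum · 1) (funext fun y => ?_)).mpr h
  rw [channelPMF_zero_left]; ring

theorem hasSum_channelPMF_mul_nat (x : ℝ) : HasSum (fun y : ℕ => channelPMF 0 x y * y) x := by
  rw [← hasSum_nat_add_iff' 1]
  simp only [Finset.range_one, Finset.sum_singleton, Nat.cast_zero, mul_zero, sub_zero]
  have h := (hasSum_channelPMF x).mul_left x
  rw [mul_one] at h
  refine (congrArg (HasSum · x) (funext fun n => ?_)).mpr h
  have : (n : ℝ) + 1 ≠ 0 := by exact_mod_cast n.succ_ne_zero
  rw [channelPMF_zero_left, channelPMF_zero_left, Nat.factorial_succ]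
  push_cast
  field_simp
  ring

theorem hasSum_channelPMF_mul_affine (x b c : ℝ) :
    HasSum (fun y : ℕ => channelPMF 0 x y * (y * b + c)) (x * b + c) := by
  have h := ((hasSum_channelPMF_mul_nat x).mul_right b).add ((hasSum_channelPMF x).mul_right c)
  rw [one_mul] at h
  exact (congrArg (HasSum · (x * b + c)) (funext fun y => by ring)).mpr h

/-! ### Moments of the input distribution -/

/-- `∫ x ^ y e^{-x} dμ`, that is, `y!` times the output pmf. -/
def tiltedMoment (μ : Measure ℝ) (y : ℕ) : ℝ := ∫ x, x ^ y * Real.exp (-x) ∂μ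

theorem outputPMF_zero_left (μ : Measure ℝ) (y : ℕ) :
    outputPMF 0 μ y = tiltedMoment μ y / y.factorial := by
  simp only [outputPMF, channelPMF_zero_left, tiltedMoment, integral_div]

section Input

variable {A : ℝ} {μ : Measure ℝ}

theorem IsInput.ae_mem (hμ : IsInput A μ) : ∀ᵐ x ∂μ, x ∈ Icc 0 A := by
  rw [ae_iff]; exact hμ.2

theorem IsInput.integrable (hμ : IsInput A μ) {f : ℝ → ℝ} (hf : Continuous f) :
    Integrable f μ := by
  have := hμ.1
  obtain ⟨c, hc⟩ := (isCompact_Icc (a := 0) (b := A)).exists_bound_of_continuousOn hf.continuousOn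
  exact .of_bound hf.aestronglyMeasurable c (hμ.ae_mem.mono hc)

theorem IsInput.integrable_tilted (hμ : IsInput A μ) (y : ℕ) :
    Integrable (fun x => x ^ y * Real.exp (-x)) μ := hμ.integrable (by fun_prop)

theorem IsInput.tiltedMoment_nonneg (hμ : IsInput A μ) (y : ℕ) : 0 ≤ tiltedMoment μ y :=
  integral_nonneg_of_ae <| hμ.ae_mem.mono fun x hx => by
    have := hx.1
    simp only [Pi.zero_apply]; positivity

theorem IsInput.tiltedMoment_zero_le (hμ : IsInput A μ) : tiltedMoment μ 0 ≤ 1 := by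
  have := hμ.1
  have : tiltedMoment μ 0 ≤ ∫ _, (1 : ℝ) ∂μ :=
    integral_mono_ae (hμ.integrable_tilted 0) (integrable_const _) <| hμ.ae_mem.mono fun x hx => by
      simpa using hx.1
  simpa using this

theorem IsInput.tiltedMoment_zero_pos (hμ : IsInput A μ) : 0 < tiltedMoment μ 0 := by
  have := hμ.1
  have : ∫ _, Real.exp (-A) ∂μ ≤ tiltedMoment μ 0 :=
    integral_mono_ae (integrable_const _) (hμ.integrable_tilted 0) <| hμ.ae_mem.mono fun x hx => by
      simpa using hx.2
  exact (Real.exp_pos (-A)).trans_le (by simpa using this)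

theorem IsInput.tiltedMoment_succ_le (hμ : IsInput A μ) (y : ℕ) :
    tiltedMoment μ (y + 1) ≤ A * tiltedMoment μ y := by
  rw [tiltedMoment, tiltedMoment, ← integral_const_mul]
  refine integral_mono_ae (hμ.integrable_tilted _) ((hμ.integrable_tilted _).const_mul _) ?_
  filter_upwards [hμ.ae_mem] with x hx
  have := hx.1
  rw [pow_succ', mul_assoc]
  exact mul_le_mul_of_nonneg_right hx.2 (by positivity)

/-- The conditional mean `E[X | Y = y]` is smallest at `y = 0`. -/
theorem IsInput.div_mul_tiltedMoment_le (hμ : IsInput A μ) (y : ℕ) :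
    tiltedMoment μ 1 / tiltedMoment μ 0 * tiltedMoment μ y ≤ tiltedMoment μ (y + 1) := by
  have h0 := hμ.tiltedMoment_zero_pos
  set m := tiltedMoment μ 1 / tiltedMoment μ 0 with hm
  have hm0 : 0 ≤ m := div_nonneg (hμ.tiltedMoment_nonneg 1) h0.le
  have hm1 : tiltedMoment μ 1 - m * tiltedMoment μ 0 = 0 := by rw [hm]; field_simp; ring
  have e1 : ∫ x, (x ^ (y + 1) * Real.exp (-x) - m * (x ^ y * Real.exp (-x))) ∂μ =
      tiltedMoment μ (y + 1) - m * tiltedMoment μ y := by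
    rw [integral_sub (hμ.integrable_tilted _) ((hμ.integrable_tilted _).const_mul _),
      integral_const_mul]; rfl
  have e2 : ∫ x, m ^ y * (x ^ 1 * Real.exp (-x) - m * (x ^ 0 * Real.exp (-x))) ∂μ = 0 := by
    rw [integral_const_mul, integral_sub (hμ.integrable_tilted _)
      ((hμ.integrable_tilted _).const_mul _), integral_const_mul]
    exact mul_eq_zero_of_right _ hm1
  have : ∫ x, m ^ y * (x ^ 1 * Real.exp (-x) - m * (x ^ 0 * Real.exp (-x))) ∂μ ≤
      ∫ x, (x ^ (y + 1) * Real.exp (-x) - m * (x ^ y * Real.exp (-x))) ∂μ := by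
    refine integral_mono_ae (hμ.integrable (by fun_prop)) (hμ.integrable (by fun_prop)) ?_
    filter_upwards [hμ.ae_mem] with x hx
    have key : 0 ≤ (x ^ y - m ^ y) * (x - m) := by
      rcases le_total x m with h | h
      · exact mul_nonneg_of_nonpos_of_nonpos
          (sub_nonpos.2 (pow_le_pow_left₀ hx.1 h y)) (sub_nonpos.2 h)
      · exact mul_nonneg (sub_nonneg.2 (pow_le_pow_left₀ hm0 h y)) (sub_nonneg.2 h)
    have := mul_nonneg key (Real.exp_pos (-x)).le
    simp only [pow_succ, pow_zero]
    linarith [this]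
  linarith

theorem IsInput.le_tiltedMoment (hμ : IsInput A μ) (y : ℕ) :
    tiltedMoment μ 0 * (tiltedMoment μ 1 / tiltedMoment μ 0) ^ y ≤ tiltedMoment μ y := by
  have hm0 : 0 ≤ tiltedMoment μ 1 / tiltedMoment μ 0 :=
    div_nonneg (hμ.tiltedMoment_nonneg 1) (hμ.tiltedMoment_nonneg 0)
  induction y with
  | zero => simp
  | succ y ih =>
    refine le_trans ?_ (hμ.div_mul_tiltedMoment_le y)
    rw [pow_succ', mul_left_comm]
    exact mul_le_mul_of_nonneg_left ih hm0

theorem IsInput.tiltedMoment_pos (hμ : IsInput A μ) (h1 : 0 < tiltedMoment μ 1) (y : ℕ) :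
    0 < tiltedMoment μ y := by
  have h0 := hμ.tiltedMoment_zero_pos
  exact lt_of_lt_of_le (by positivity) (hμ.le_tiltedMoment y)

theorem IsInput.tiltedMoment_succ_le_pow (hA : 0 ≤ A) (hμ : IsInput A μ) (y : ℕ) :
    tiltedMoment μ (y + 1) ≤ A ^ y * tiltedMoment μ 1 := by
  induction y with
  | zero => simp
  | succ y ih =>
    refine (hμ.tiltedMoment_succ_le (y + 1)).trans ?_
    rw [pow_succ', mul_assoc]
    exact mul_le_mul_of_nonneg_left ih hA

theorem IsInput.tiltedMoment_le_pow (hA : 0 ≤ A) (hμ : IsInput A μ) (y : ℕ) :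
    tiltedMoment μ y ≤ A ^ y := by
  induction y with
  | zero => simpa using hμ.tiltedMoment_zero_le
  | succ y ih =>
    refine (hμ.tiltedMoment_succ_le y).trans ?_
    rw [pow_succ']
    exact mul_le_mul_of_nonneg_left ih hA

theorem IsInput.geomBounded_log (hA : 0 < A) (hμ : IsInput A μ) (h1 : 0 < tiltedMoment μ 1) :
    GeomBounded fun y => Real.log (tiltedMoment μ y) := by
  have h0 := hμ.tiltedMoment_zero_pos
  set m := tiltedMoment μ 1 / tiltedMoment μ 0 with hm
  have hm0 : 0 < m := div_pos h1 h0
  refine geomBounded_of_abs_le_affine (c := |Real.log (tiltedMoment μ 0)|)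
    (d := |Real.log m| + |Real.log A|) (by positivity) (by positivity) fun y => ?_
  have hlow := Real.log_le_log (by positivity) (hμ.le_tiltedMoment y)
  rw [← hm, Real.log_mul h0.ne' (by positivity), Real.log_pow] at hlow
  have hup := Real.log_le_log (hμ.tiltedMoment_pos h1 y) (hμ.tiltedMoment_le_pow hA.le y)
  rw [Real.log_pow] at hup
  have hy : (0 : ℝ) ≤ y := y.cast_nonneg
  have e1 := mul_le_mul_of_nonneg_left (neg_abs_le (Real.log m)) hy
  have e2 := mul_le_mul_of_nonneg_left (le_abs_self (Real.log A)) hy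
  have e3 := mul_nonneg hy (abs_nonneg (Real.log m))
  have e4 := mul_nonneg hy (abs_nonneg (Real.log A))
  rw [abs_le]
  constructor
  · linarith [neg_abs_le (Real.log (tiltedMoment μ 0))]
  · linarith [abs_nonneg (Real.log (tiltedMoment μ 0))]

/-- The increments of `log E[X | Y = y]` are bounded. -/
theorem IsInput.abs_second_diff_log_le (hμ : IsInput A μ) (h1 : 0 < tiltedMoment μ 1)
    (y : ℕ) :
    |(Real.log (tiltedMoment μ (y + 1 + 1)) - Real.log (tiltedMoment μ (y + 1))) -
        (Real.log (tiltedMoment μ (y + 1)) - Real.log (tiltedMoment μ y))| ≤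
      Real.log A - Real.log (tiltedMoment μ 1) + Real.log (tiltedMoment μ 0) := by
  have hpos := hμ.tiltedMoment_pos h1
  have hA : 0 < A := by
    by_contra hA
    exact (hpos 1).not_ge ((hμ.tiltedMoment_succ_le 0).trans
      (mul_nonpos_of_nonpos_of_nonneg (not_lt.1 hA) (hpos 0).le))
  have key : ∀ n, Real.log (tiltedMoment μ 1) - Real.log (tiltedMoment μ 0) ≤
      Real.log (tiltedMoment μ (n + 1)) - Real.log (tiltedMoment μ n) ∧
      Real.log (tiltedMoment μ (n + 1)) - Real.log (tiltedMoment μ n) ≤ Real.log A := by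
    intro n
    have hlow := Real.log_le_log (mul_pos (div_pos h1 (hpos 0)) (hpos n))
      (hμ.div_mul_tiltedMoment_le n)
    rw [Real.log_mul (div_pos h1 (hpos 0)).ne' (hpos n).ne',
      Real.log_div h1.ne' (hpos 0).ne'] at hlow
    have hup := Real.log_le_log (hpos _) (hμ.tiltedMoment_succ_le n)
    rw [Real.log_mul hA.ne' (hpos n).ne'] at hup
    constructor <;> linarith
  have k1 := key y
  have k2 := key (y + 1)
  rw [abs_le]
  constructor <;> linarith

/-! ### Mutual information -/

/-- Integration of Poisson averages term by term. -/
theorem IsInput.hasSum_integral_poissonMean (hA : 0 ≤ A) (hμ : IsInput A μ) {L : ℕ → ℝ}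
    (hL : GeomBounded L) :
    HasSum (fun y => tiltedMoment μ y / y.factorial * L y) (∫ x, poissonMean L x ∂μ) := by
  have := hμ.1
  obtain ⟨c, hc⟩ := hL
  have hint : ∀ y : ℕ, Integrable (fun x => channelPMF 0 x y * L y) μ := fun y => by
    simp only [channelPMF_zero_left]
    exact ((hμ.integrable_tilted y).div_const _).mul_const _
  have h := hasSum_integral_of_summable_integral_norm hint ?_
  · refine (congrArg (HasSum · _) (funext fun y => ?_)).mpr h
    simp only [channelPMF_zero_left]
    rw [integral_mul_const, integral_div]; rfl
  · refine .of_nonneg_of_le (fun y => integral_nonneg fun _ => norm_nonneg _) (fun y => ?_)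
      ((Real.summable_pow_div_factorial (2 * A)).mul_left c)
    have : ∫ x, ‖channelPMF 0 x y * L y‖ ∂μ ≤ ∫ _, c * ((2 * A) ^ y / y.factorial) ∂μ := by
      refine integral_mono_ae (hint y).norm (integrable_const _) ?_
      filter_upwards [hμ.ae_mem] with x hx
      rw [norm_mul, norm_eq_abs, norm_eq_abs, abs_of_nonneg (channelPMF_zero_nonneg hx.1 y),
        channelPMF_zero_left]
      have h1 : x ^ y * Real.exp (-x) ≤ A ^ y := by
        have h2 : Real.exp (-x) ≤ 1 := by simpa using hx.1
        have h3 : x ^ y ≤ A ^ y := pow_le_pow_left₀ hx.1 hx.2 y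
        have h4 : 0 ≤ x ^ y := pow_nonneg hx.1 y
        nlinarith
      calc x ^ y * Real.exp (-x) / y.factorial * |L y| ≤ A ^ y / y.factorial * (c * 2 ^ y) := by
            gcongr; exact hc y
        _ = c * ((2 * A) ^ y / y.factorial) := by rw [mul_pow]; ring
    simpa using this

theorem geomBounded_one : GeomBounded fun _ => 1 :=
  geomBounded_of_abs_le_affine (c := 1) (d := 0) (by simp) le_rfl (by simp)

theorem IsInput.hasSum_tiltedMoment (hA : 0 ≤ A) (hμ : IsInput A μ) :
    HasSum (fun y => tiltedMoment μ y / y.factorial) 1 := by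
  have := hμ.1
  have h := hμ.hasSum_integral_poissonMean hA geomBounded_one
  have e : ∀ x, poissonMean (fun _ => 1) x = 1 := fun x => by
    simp only [poissonMean, mul_one]; exact (hasSum_channelPMF x).tsum_eq
  simpa [e] using h

/-- Gibbs' inequality for the output distribution. -/
theorem IsInput.integral_poissonMean_log_le (hA : 0 < A) (hμ : IsInput A μ)
    (h1 : 0 < tiltedMoment μ 1) {b : ℕ → ℝ} (hb : ∀ y, 0 < b y)
    (hsum : HasSum (fun y => b y / y.factorial) 1) (hL : GeomBounded fun y => Real.log (b y)) :
    ∫ x, poissonMean (fun y => Real.log (b y)) x ∂μ ≤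
      ∫ x, poissonMean (fun y => Real.log (tiltedMoment μ y)) x ∂μ := by
  have hs := (hμ.hasSum_integral_poissonMean hA.le hL).sub
    (hμ.hasSum_integral_poissonMean hA.le (hμ.geomBounded_log hA h1))
  have := hasSum_le (fun y => ?_) hs (hsum.sub (hμ.hasSum_tiltedMoment hA.le))
  · linarith
  · have ha := hμ.tiltedMoment_pos h1 y
    have hlog := Real.log_le_sub_one_of_pos (div_pos (hb y) ha)
    rw [Real.log_div (hb y).ne' ha.ne'] at hlog
    have hf : (0 : ℝ) < y.factorial := by positivity
    calc tiltedMoment μ y / y.factorial * Real.log (b y) -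
          tiltedMoment μ y / y.factorial * Real.log (tiltedMoment μ y)
        = tiltedMoment μ y / y.factorial * (Real.log (b y) - Real.log (tiltedMoment μ y)) := by ring
      _ ≤ tiltedMoment μ y / y.factorial * (b y / tiltedMoment μ y - 1) := by gcongr
      _ = b y / y.factorial - tiltedMoment μ y / y.factorial := by field_simp

/-- A continuous extension of `i(x; μ)` to the real line. -/
def infoDensity (μ : Measure ℝ) (x : ℝ) : ℝ :=
  x * Real.log x - x - poissonMean (fun y => Real.log (tiltedMoment μ y)) x

theorem IsInput.continuous_infoDensity (hA : 0 < A) (hμ : IsInput A μ)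
    (h1 : 0 < tiltedMoment μ 1) : Continuous (infoDensity μ) :=
  (Real.continuous_mul_log.sub continuous_id).sub
    (hμ.geomBounded_log hA h1).continuous_poissonMean

theorem IsInput.iFun_eq (hA : 0 < A) (hμ : IsInput A μ) (h1 : 0 < tiltedMoment μ 1)
    {x : ℝ} (hx : 0 ≤ x) : iFun 0 μ x = infoDensity μ x := by
  have hs := (hasSum_channelPMF_mul_affine x (Real.log x) (-x)).sub
    ((hμ.geomBounded_log hA h1).hasSum_poissonMean x)
  rw [← sub_eq_add_neg] at hs
  rw [iFun, klDiv, infoDensity, ← hs.tsum_eq]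
  refine tsum_congr fun y => ?_
  have ha := hμ.tiltedMoment_pos h1 y
  rcases hx.eq_or_lt with rfl | hx
  · rcases y.eq_zero_or_pos with rfl | hy
    · simp [channelPMF_zero_left, outputPMF_zero_left]
    · simp [channelPMF_zero_left, hy.ne']
  · have hf : (y.factorial : ℝ) ≠ 0 := by positivity
    have hlog : Real.log (channelPMF 0 x y / outputPMF 0 μ y) =
        y * Real.log x - x - Real.log (tiltedMoment μ y) := by
      rw [channelPMF_zero_left, outputPMF_zero_left, div_div_div_cancel_right₀ hf,
        Real.log_div (by positivity) ha.ne', Real.log_mul (by positivity) (by positivity),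
        Real.log_pow, Real.log_exp]
      ring
    rw [hlog]; ring

theorem IsInput.mutualInfo_eq (hA : 0 < A) (hμ : IsInput A μ) (h1 : 0 < tiltedMoment μ 1) :
    mutualInfo 0 μ = ∫ x, infoDensity μ x ∂μ :=
  integral_congr_ae <| hμ.ae_mem.mono fun _ hx => hμ.iFun_eq hA h1 hx.1

theorem IsInput.ae_eq_zero_of_tiltedMoment_nonpos (hμ : IsInput A μ)
    (h1 : tiltedMoment μ 1 ≤ 0) : ∀ᵐ x ∂μ, x = 0 := by
  have h0 : tiltedMoment μ 1 = 0 := le_antisymm h1 (hμ.tiltedMoment_nonneg 1)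
  rw [tiltedMoment, integral_eq_zero_iff_of_nonneg_ae _ (hμ.integrable_tilted 1)] at h0
  · filter_upwards [h0] with x hx
    simpa [Real.exp_ne_zero] using hx
  · filter_upwards [hμ.ae_mem] with x hx
    have := hx.1
    simp only [Pi.zero_apply]; positivity

theorem IsInput.mutualInfo_eq_zero_of_tiltedMoment_nonpos (hμ : IsInput A μ)
    (h1 : tiltedMoment μ 1 ≤ 0) : mutualInfo 0 μ = 0 := by
  have := hμ.1
  have hae := hμ.ae_eq_zero_of_tiltedMoment_nonpos h1
  have e0 : tiltedMoment μ 0 = 1 := by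
    have : tiltedMoment μ 0 = ∫ _, (1 : ℝ) ∂μ :=
      integral_congr_ae (hae.mono fun x hx => by simp [hx])
    simpa using this
  have e : iFun 0 μ 0 = 0 := by
    rw [iFun, klDiv, ← tsum_zero (β := ℕ) (α := ℝ)]
    refine tsum_congr fun y => ?_
    rcases y.eq_zero_or_pos with rfl | hy
    · simp [channelPMF_zero_left, outputPMF_zero_left, e0]
    · simp [channelPMF_zero_left, hy.ne']
  have : mutualInfo 0 μ = ∫ _, (0 : ℝ) ∂μ :=
    integral_congr_ae (hae.mono fun x hx => by simp [hx, e])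
  simpa using this

/-- Comparing with the Poisson output of parameter `A` bounds the mutual information by `A`. -/
theorem IsInput.mutualInfo_le (hA : 0 < A) (hμ : IsInput A μ) : mutualInfo 0 μ ≤ A := by
  have := hμ.1
  rcases le_or_gt (tiltedMoment μ 1) 0 with h1 | h1
  · rw [hμ.mutualInfo_eq_zero_of_tiltedMoment_nonpos h1]; exact hA.le
  have hb : ∀ y : ℕ, Real.log (A ^ y * Real.exp (-A)) = y * Real.log A + -A := fun y => by
    rw [Real.log_mul (by positivity) (by positivity), Real.log_pow, Real.log_exp]
  have hbL : GeomBounded fun y : ℕ => Real.log (A ^ y * Real.exp (-A)) := by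
    refine geomBounded_of_abs_le_affine (c := |A|) (d := |Real.log A|) (by positivity)
      (by positivity) fun y => ?_
    rw [hb]
    refine (abs_add_le _ _).trans_eq ?_
    rw [abs_mul, abs_neg, Nat.abs_cast]; ring
  have hmean : ∀ x, poissonMean (fun y : ℕ => Real.log (A ^ y * Real.exp (-A))) x =
      x * Real.log A + -A := fun x => by
    simp only [hb]; exact (hasSum_channelPMF_mul_affine x _ _).tsum_eq
  have hsum : HasSum (fun y : ℕ => A ^ y * Real.exp (-A) / y.factorial) 1 := by
    exact (congrArg (HasSum · 1) (funext fun y => (channelPMF_zero_left A y).symm)).mpr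
      (hasSum_channelPMF A)
  have hg := hμ.integral_poissonMean_log_le hA h1 (fun y => by positivity) hsum hbL
  have hc := Real.continuous_mul_log.sub continuous_id
  have i1 := hμ.integrable hc
  have i2 := hμ.integrable (hμ.geomBounded_log hA h1).continuous_poissonMean
  have i3 := hμ.integrable hbL.continuous_poissonMean
  have e1 : mutualInfo 0 μ = ∫ x, (x * Real.log x - x) ∂μ -
      ∫ x, poissonMean (fun y => Real.log (tiltedMoment μ y)) x ∂μ := by
    rw [hμ.mutualInfo_eq hA h1]; exact integral_sub i1 i2
  have e2 : ∫ x, (x * Real.log x - x -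
      poissonMean (fun y : ℕ => Real.log (A ^ y * Real.exp (-A))) x) ∂μ =
      ∫ x, (x * Real.log x - x) ∂μ -
      ∫ x, poissonMean (fun y : ℕ => Real.log (A ^ y * Real.exp (-A))) x ∂μ := integral_sub i1 i3
  have e3 : ∫ x, (x * Real.log x - x -
      poissonMean (fun y : ℕ => Real.log (A ^ y * Real.exp (-A))) x) ∂μ ≤ ∫ _, A ∂μ := by
    refine integral_mono_ae (i1.sub i3) (integrable_const _) ?_
    filter_upwards [hμ.ae_mem] with x hx
    rw [hmean]
    rcases hx.1.eq_or_lt with rfl | hx0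
    · simp
    · have := mul_le_mul_of_nonneg_left (Real.log_le_log hx0 hx.2) hx.1
      linarith
  simp only [integral_const, probReal_univ, one_smul] at e3
  linarith

theorem bddAbove_mutualInfo (hA : 0 < A) :
    BddAbove (mutualInfo 0 '' {μ : Measure ℝ | IsInput A μ}) := by
  refine ⟨A, ?_⟩
  rintro _ ⟨μ, hμ, rfl⟩
  exact IsInput.mutualInfo_le hA hμ

/-! ### Optimality conditions -/

/-- The input distribution obtained from `μ` by moving a fraction `t` of the mass to `x`. -/
def mixDirac (μ : Measure ℝ) (t x : ℝ) : Measure ℝ :=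
  ENNReal.ofReal (1 - t) • μ + ENNReal.ofReal t • Measure.dirac x

theorem IsInput.isInput_mixDirac (hμ : IsInput A μ) {t x : ℝ} (ht : t ∈ Ioo 0 1) (hx : x ∈ Icc 0 A) :
    IsInput A (mixDirac μ t x) := by
  have := hμ.1
  refine ⟨⟨?_⟩, ?_⟩
  · simp only [mixDirac, Measure.coe_add, Measure.coe_smul, Pi.add_apply, Pi.smul_apply,
      measure_univ, smul_eq_mul, mul_one]
    rw [← ENNReal.ofReal_add (by linarith [ht.2]) ht.1.le]; simp
  · simp [mixDirac, hμ.2, measurableSet_Icc.compl, hx.1, hx.2]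

theorem IsInput.integral_mixDirac (hμ : IsInput A μ) {t x : ℝ} (ht : t ∈ Ioo 0 1)
    {f : ℝ → ℝ} (hf : Continuous f) :
    ∫ u, f u ∂(mixDirac μ t x) = (1 - t) * ∫ u, f u ∂μ + t * f x := by
  rw [mixDirac, integral_add_measure, integral_smul_measure, integral_smul_measure,
    integral_dirac, ENNReal.toReal_ofReal (by linarith [ht.2]), ENNReal.toReal_ofReal ht.1.le]
  · rfl
  · exact (hμ.integrable hf).smul_measure ENNReal.ofReal_ne_top
  · exact (integrable_dirac (by simp)).smul_measure ENNReal.ofReal_ne_top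

theorem IsCapacityAchieving.integral_infoDensity (hA : 0 < A) (hμ : IsCapacityAchieving A 0 μ)
    (h1 : 0 < tiltedMoment μ 1) : ∫ x, infoDensity μ x ∂μ = capacity A 0 :=
  (hμ.1.mutualInfo_eq hA h1).symm.trans hμ.2

theorem IsInput.summable_chi_sq (hA : 0 ≤ A) (hμ : IsInput A μ) (h1 : 0 < tiltedMoment μ 1)
    {x : ℝ} (hx : x ∈ Icc 0 A) :
    Summable fun y => channelPMF 0 x y * (x ^ y * Real.exp (-x) / tiltedMoment μ y) := by
  have h0 := hμ.tiltedMoment_zero_pos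
  set m := tiltedMoment μ 1 / tiltedMoment μ 0 with hm
  have hm0 : 0 < m := div_pos h1 h0
  have hx0 := hx.1
  refine .of_nonneg_of_le (fun y => ?_) (fun y => ?_)
    ((Real.summable_pow_div_factorial (A * A / m)).mul_left (1 / tiltedMoment μ 0))
  · have := hμ.tiltedMoment_pos h1 y
    have := channelPMF_zero_nonneg hx0 y
    positivity
  · have ha := hμ.tiltedMoment_pos h1 y
    have hle := hμ.le_tiltedMoment y
    have h2 : x ^ y * Real.exp (-x) ≤ A ^ y := by
      have h2 : Real.exp (-x) ≤ 1 := by simpa using hx0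
      have h3 : x ^ y ≤ A ^ y := pow_le_pow_left₀ hx0 hx.2 y
      have h4 : 0 ≤ x ^ y := pow_nonneg hx0 y
      nlinarith
    rw [channelPMF_zero_left]
    calc x ^ y * Real.exp (-x) / y.factorial * (x ^ y * Real.exp (-x) / tiltedMoment μ y)
        ≤ A ^ y / y.factorial * (A ^ y / (tiltedMoment μ 0 * m ^ y)) := by
          gcongr
      _ = _ := by
          have : (A * A / m) ^ y = A ^ y * A ^ y / m ^ y := by rw [div_pow, mul_pow]
          rw [this]; field_simp

/-- The derivative of the mutual information along `mixDirac`, in the form of an inequality. -/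
theorem IsCapacityAchieving.infoDensity_sub_le (hA : 0 < A) (hμ : IsCapacityAchieving A 0 μ)
    (h1 : 0 < tiltedMoment μ 1) {t x : ℝ} (ht : t ∈ Ioo 0 1) (hx : x ∈ Icc 0 A) :
    infoDensity μ x - t * ∑' y, channelPMF 0 x y * (x ^ y * Real.exp (-x) / tiltedMoment μ y) ≤
      capacity A 0 := by
  have ht' : 0 < 1 - t := by linarith [ht.2]
  have hν := hμ.1.isInput_mixDirac ht hx
  set ν := mixDirac μ t x with hνdef
  have hmom : ∀ y, tiltedMoment ν y = (1 - t) * tiltedMoment μ y + t * (x ^ y * Real.exp (-x)) :=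
    fun y => hμ.1.integral_mixDirac ht (f := fun u => u ^ y * Real.exp (-u)) (by fun_prop)
  have hx0 := hx.1
  have hν1 : 0 < tiltedMoment ν 1 := by
    have := ht.1
    rw [hmom]; positivity
  have hL := hμ.1.geomBounded_log hA h1
  have hLν := hν.geomBounded_log hA hν1
  have hcap : mutualInfo 0 ν ≤ capacity A 0 := le_csSup (bddAbove_mutualInfo hA) ⟨ν, hν, rfl⟩
  rw [hν.mutualInfo_eq hA hν1, hμ.1.integral_mixDirac ht (hν.continuous_infoDensity hA hν1)] at hcap
  have hc := Real.continuous_mul_log.sub continuous_id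
  have hgibbs := hμ.1.integral_poissonMean_log_le hA h1 (hν.tiltedMoment_pos hν1)
    (hν.hasSum_tiltedMoment hA.le) hLν
  have e1 : ∫ u, infoDensity ν u ∂μ = ∫ u, (u * Real.log u - u) ∂μ -
      ∫ u, poissonMean (fun y => Real.log (tiltedMoment ν y)) u ∂μ :=
    integral_sub (hμ.1.integrable hc) (hμ.1.integrable hLν.continuous_poissonMean)
  have e2 : ∫ u, infoDensity μ u ∂μ = ∫ u, (u * Real.log u - u) ∂μ -
      ∫ u, poissonMean (fun y => Real.log (tiltedMoment μ y)) u ∂μ :=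
    integral_sub (hμ.1.integrable hc) (hμ.1.integrable hL.continuous_poissonMean)
  rw [hμ.integral_infoDensity hA h1] at e2
  have hge : (1 - t) * capacity A 0 ≤ (1 - t) * ∫ u, infoDensity ν u ∂μ :=
    mul_le_mul_of_nonneg_left (by linarith) ht'.le
  have hνx : infoDensity ν x ≤ capacity A 0 := by
    have : t * infoDensity ν x ≤ t * capacity A 0 := by linarith
    exact le_of_mul_le_mul_left this ht.1
  have hdiff : poissonMean (fun y => Real.log (tiltedMoment ν y)) x -
      poissonMean (fun y => Real.log (tiltedMoment μ y)) x ≤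
      t * ∑' y, channelPMF 0 x y * (x ^ y * Real.exp (-x) / tiltedMoment μ y) := by
    refine hasSum_le (fun y => ?_) ((hLν.hasSum_poissonMean x).sub (hL.hasSum_poissonMean x))
      ((hμ.1.summable_chi_sq hA.le h1 hx).hasSum.mul_left t)
    have ha := hμ.1.tiltedMoment_pos h1 y
    have hb := hν.tiltedMoment_pos hν1 y
    have hlog := Real.log_le_sub_one_of_pos (div_pos hb ha)
    have hle : tiltedMoment ν y / tiltedMoment μ y - 1 ≤
        t * (x ^ y * Real.exp (-x) / tiltedMoment μ y) := by
      have : tiltedMoment ν y / tiltedMoment μ y =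
          (1 - t) + t * (x ^ y * Real.exp (-x) / tiltedMoment μ y) := by
        rw [hmom]; field_simp
      linarith [ht.1]
    rw [Real.log_div hb.ne' ha.ne'] at hlog
    have := mul_le_mul_of_nonneg_left (hlog.trans hle) (channelPMF_zero_nonneg hx0 y)
    linarith
  simp only [infoDensity] at hνx ⊢
  linarith

theorem IsCapacityAchieving.infoDensity_le (hA : 0 < A) (hμ : IsCapacityAchieving A 0 μ)
    (h1 : 0 < tiltedMoment μ 1) {x : ℝ} (hx : x ∈ Icc 0 A) :
    infoDensity μ x ≤ capacity A 0 := by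
  set χ := ∑' y, channelPMF 0 x y * (x ^ y * Real.exp (-x) / tiltedMoment μ y) with hχ
  have hlim : Filter.Tendsto (fun t : ℝ => infoDensity μ x - t * χ) (nhdsWithin 0 (Ioi 0))
      (nhds (infoDensity μ x)) := by
    have : Continuous fun t : ℝ => infoDensity μ x - t * χ := by fun_prop
    simpa using (this.tendsto 0).mono_left nhdsWithin_le_nhds
  refine le_of_tendsto hlim ?_
  filter_upwards [Ioo_mem_nhdsGT (zero_lt_one (α := ℝ))] with t ht
  exact hμ.infoDensity_sub_le hA h1 ht hx

theorem IsInput.msupport_subset (hμ : IsInput A μ) : msupport μ ⊆ Icc 0 A := by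
  intro x hx
  by_contra hxA
  exact (hx _ isClosed_Icc.isOpen_compl hxA).ne' hμ.2

theorem IsCapacityAchieving.infoDensity_eq (hA : 0 < A) (hμ : IsCapacityAchieving A 0 μ)
    (h1 : 0 < tiltedMoment μ 1) {x : ℝ} (hx : x ∈ msupport μ) :
    infoDensity μ x = capacity A 0 := by
  have := hμ.1.1
  have hc := hμ.1.continuous_infoDensity hA h1
  have hae : (fun x => capacity A 0 - infoDensity μ x) =ᵐ[μ] 0 := by
    have hi : Integrable (fun x => capacity A 0 - infoDensity μ x) μ :=
      hμ.1.integrable (continuous_const.sub hc)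
    rw [← integral_eq_zero_iff_of_nonneg_ae _ hi,
      integral_sub (integrable_const _) (hμ.1.integrable hc), hμ.integral_infoDensity hA h1]
    · simp
    · filter_upwards [hμ.1.ae_mem] with x hx
      exact sub_nonneg.2 (hμ.infoDensity_le hA h1 hx)
  by_contra hne
  refine (hx {u | infoDensity μ u ≠ capacity A 0}
    (isOpen_ne_fun hc continuous_const) hne).ne' ?_
  have : ∀ᵐ u ∂μ, infoDensity μ u = capacity A 0 := hae.mono fun u hu => by
    simp only [Pi.zero_apply] at hu; linarith
  exact this

/-- The optimal input distribution cannot concentrate too close to `0`. -/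
theorem IsCapacityAchieving.log_sub_log_tiltedMoment_le (hA : 1 ≤ A)
    (hμ : IsCapacityAchieving A 0 μ) (h1 : 0 < tiltedMoment μ 1) :
    Real.log A - Real.log (tiltedMoment μ 1) ≤ 4 * A := by
  have hA0 : 0 < A := by linarith
  have hcap : capacity A 0 ≤ A := hμ.2 ▸ hμ.1.mutualInfo_le hA0
  have hle := (hμ.infoDensity_le hA0 h1 (right_mem_Icc.2 hA0.le)).trans hcap
  set l := Real.log (tiltedMoment μ 1) - Real.log A with hl
  have hmean : poissonMean (fun y => Real.log (tiltedMoment μ y)) A ≤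
      A * Real.log A + l - Real.exp (-A) * l := by
    refine hasSum_le (fun y => ?_)
      ((hμ.1.geomBounded_log hA0 h1).hasSum_poissonMean A)
      ((hasSum_channelPMF_mul_affine A (Real.log A) l).sub
        (hasSum_ite_eq 0 (Real.exp (-A) * l)))
    rcases y with - | y
    · have := Real.log_nonpos (hμ.1.tiltedMoment_nonneg 0) hμ.1.tiltedMoment_zero_le
      have := mul_nonpos_of_nonneg_of_nonpos (Real.exp_pos (-A)).le this
      simpa [channelPMF_zero_left] using this
    · have hlog := Real.log_le_log (hμ.1.tiltedMoment_pos h1 (y + 1))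
        (hμ.1.tiltedMoment_succ_le_pow hA0.le y)
      rw [Real.log_mul (by positivity) h1.ne', Real.log_pow] at hlog
      simp only [Nat.add_eq_zero_iff, one_ne_zero, and_false, if_false, sub_zero]
      refine mul_le_mul_of_nonneg_left ?_ (channelPMF_zero_nonneg hA0.le _)
      push_cast
      linarith
  have hl0 : l ≤ 0 := by
    have h2 : tiltedMoment μ 1 ≤ A := by simpa using hμ.1.tiltedMoment_le_pow hA0.le 1
    linarith [Real.log_le_log h1 h2]
  have hexp : Real.exp (-A) ≤ 1 / 2 := by
    have := Real.add_one_le_exp A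
    rw [Real.exp_neg, one_div]
    exact inv_anti₀ (by norm_num) (by linarith)
  rw [infoDensity] at hle
  nlinarith

end Input

/-! ### The support bound -/

theorem IsCapacityAchieving.card_le_of_subset_msupport {A : ℝ} {μ : Measure ℝ}
    (hA : 1 ≤ A) (hμ : IsCapacityAchieving A 0 μ) (h1 : 0 < tiltedMoment μ 1) (S : Finset ℝ)
    (hS : (S : Set ℝ) ⊆ msupport μ) (hS2 : 2 ≤ S.card) :
    2 * (S.card : ℝ) ≤
      4 + Real.log (1 + A * Real.exp (2 * Real.exp 1 * A + 1) * (4 * A)) := by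
  have hA0 : 0 < A := by linarith
  set L := fun y => Real.log (tiltedMoment μ y) with hL
  have hLb : GeomBounded L := hμ.1.geomBounded_log hA0 h1
  have hD : GeomBounded fun y => L (y + 1) - L y := hLb.shift.sub hLb
  set D := fun y => L (y + 1) - L y with hDdef
  have hDD : GeomBounded fun y => D (y + 1) - D y := hD.shift.sub hD
  obtain ⟨T, hcard, hT⟩ := exists_finset_second_deriv_eq_zero (f := infoDensity μ)
    (f' := fun x => Real.log x - poissonMean D x)
    (f'' := fun x => x⁻¹ - poissonMean (fun y => D (y + 1) - D y) x)
    (a := 0) (b := A) (c := capacity A 0)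
    (hμ.1.continuous_infoDensity hA0 h1).continuousOn
    (fun x hx => (((Real.hasDerivAt_mul_log hx.1.ne').sub (hasDerivAt_id x)).sub
      (hLb.hasDerivAt_poissonMean x)).congr_deriv (by ring))
    (fun x hx => (Real.hasDerivAt_log hx.1.ne').sub (hD.hasDerivAt_poissonMean x))
    (fun x hx => hμ.infoDensity_le hA0 h1 hx) S hS2
    (hS.trans hμ.1.msupport_subset) (fun x hx => hμ.infoDensity_eq hA0 h1 (hS hx))
  have hbound : ∀ y, |D (y + 1) - D y| ≤ 4 * A := fun y =>
    (hμ.1.abs_second_diff_log_le h1 y).trans <| by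
      have h2 := hμ.log_sub_log_tiltedMoment_le hA h1
      have h3 := Real.log_nonpos (hμ.1.tiltedMoment_nonneg 0) hμ.1.tiltedMoment_zero_le
      linarith
  have := card_zeros_le_log hA0 hDD hbound T (fun t ht => (hT t ht).1) (fun t ht => by
    obtain ⟨h2, h3⟩ := hT t ht
    rw [poissonTransform_ofReal]
    norm_cast
    rw [← sub_eq_zero.1 h3, mul_inv_cancel₀ h2.1.ne', sub_self])
  have hcard' : 2 * (S.card : ℝ) ≤ T.card + 4 := by exact_mod_cast hcard
  linarith

theorem IsInput.msupport_subset_singleton {A : ℝ} {μ : Measure ℝ} (hμ : IsInput A μ)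
    (h1 : tiltedMoment μ 1 ≤ 0) : msupport μ ⊆ {0} := by
  intro x hx
  by_contra hx0
  exact (hx {0}ᶜ isOpen_compl_singleton hx0).ne' (hμ.ae_eq_zero_of_tiltedMoment_nonpos h1)

theorem finite_and_ncard_le_of_finset_card_le {s : Set ℝ} {b : ℝ}
    (h : ∀ S : Finset ℝ, (S : Set ℝ) ⊆ s → (S.card : ℝ) ≤ b) :
    s.Finite ∧ (s.ncard : ℤ) ≤ ⌊b⌋ := by
  have hfin : s.Finite := by
    by_contra hinf
    obtain ⟨n, hn⟩ := exists_nat_gt b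
    obtain ⟨S, hS, rfl⟩ := Set.Infinite.exists_subset_card_eq hinf n
    exact (h S hS).not_gt hn
  refine ⟨hfin, Int.le_floor.2 ?_⟩
  rw [Set.ncard_eq_toFinset_card s hfin]
  exact_mod_cast h hfin.toFinset (by simp)

/-- Upper bound on the number of support points, zero dark current. -/
theorem support_card_upper_bound_zero_dark_current (A : ℝ) (hA : Real.exp 1 < A)
    (μ : Measure ℝ) (hμ : IsCapacityAchieving A 0 μ) :
    (msupport μ).Finite ∧
      ((msupport μ).ncard : ℤ) ≤
        ⌊3 + Real.log (1 + A * Real.exp (2 * Real.exp 1 * A + 1) *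
          (Real.log A + Real.sqrt (2 * (Real.log A - 1))))⌋ := by
  have he : 1 ≤ Real.exp 1 := by simp
  have hA1 : 1 ≤ A := he.trans hA.le
  set u := A * Real.exp (2 * Real.exp 1 * A + 1) with hu
  have hAu : A ≤ u := le_mul_of_one_le_right (by linarith) (Real.one_le_exp (by positivity))
  set v := Real.log A + Real.sqrt (2 * (Real.log A - 1)) with hv
  have hv1 : 1 ≤ v := by
    have := (Real.le_log_iff_exp_le (by linarith)).2 hA.le
    linarith [Real.sqrt_nonneg (2 * (Real.log A - 1))]
  have huv : Real.log (1 + u) ≤ Real.log (1 + u * v) :=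
    Real.log_le_log (by linarith) (by nlinarith)
  have hlog0 : 0 ≤ Real.log (1 + u) := Real.log_nonneg (by linarith)
  refine finite_and_ncard_le_of_finset_card_le fun S hS => ?_
  rcases lt_or_ge S.card 2 with hS2 | hS2
  · have : (S.card : ℝ) ≤ 2 := by exact_mod_cast hS2.le
    linarith
  rcases le_or_gt (tiltedMoment μ 1) 0 with h1 | h1
  · have : S ⊆ {0} := fun x hx => by
      simpa using hμ.1.msupport_subset_singleton h1 (hS hx)
    have := Finset.card_le_card this
    simp only [Finset.card_singleton] at this
    omega
  have key := hμ.card_le_of_subset_msupport hA1 h1 S hS hS2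
  have hle : Real.log (1 + u * (4 * A)) ≤ 2 + 2 * Real.log (1 + u) := by
    rw [Real.log_le_iff_le_exp (by positivity), Real.exp_add, two_mul (Real.log (1 + u)),
      Real.exp_add, Real.exp_log (by linarith)]
    have : (2 : ℝ) ^ 2 ≤ Real.exp 2 := by
      have h2 : (2 : ℝ) ≤ Real.exp 1 := by linarith [Real.add_one_le_exp (1 : ℝ)]
      calc (2 : ℝ) ^ 2 ≤ Real.exp 1 ^ 2 := by gcongr
        _ = Real.exp 2 := by rw [← Real.exp_nat_mul]; norm_num
    nlinarith [mul_le_mul_of_nonneg_left hAu (show 0 ≤ u by linarith)]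
  linarith
end
end

section
/- Let A > 0, λ ≥ 0, and let μ be a probability measure supported in [0,A] with μ((0,A]) > 0 or λ > 0, so that m_y := ∫ (x+λ)^y e^{-(x+λ)} dμ(x) > 0 for all y ∈ ℕ. Define G(x) = Σ_{y=0}^∞ P_{Y|X}(y|x) · log(1/(y! · P_Y(y))), where P_Y(y) = m_y/y!. Then for every x > 0, G is differentiable at x and G'(x) = Σ_{y=0}^∞ P_{Y|X}(y|x) · log(m_y / m_{y+1}). -/
open MeasureTheory Real Set

noncomputable section

/-- `m_y = ∫ (x+lam)^y e^{-(x+lam)} dμ(x)`, so the output pmf is `P_Y(y) = m_y / y!`. -/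
def mom (lam : ℝ) (μ : Measure ℝ) (y : ℕ) : ℝ :=
  ∫ x, (x + lam) ^ y * Real.exp (-(x + lam)) ∂μ

/-- `G(x) = Σ_y P_{Y|X}(y|x) log(1 / (y! P_Y(y)))` with `P_Y(y) = m_y / y!`. -/
def GFun (lam : ℝ) (μ : Measure ℝ) (x : ℝ) : ℝ :=
  ∑' y : ℕ, channelPMF lam x y *
    Real.log (1 / ((Nat.factorial y : ℝ) * (mom lam μ y / (Nat.factorial y : ℝ))))

theorem summable_pow_div_factorial_mul {c : ℕ → ℝ} {C K : ℝ}
    (hc : ∀ n, |c n| ≤ C * K ^ n) (s : ℝ) :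
    Summable fun n : ℕ => s ^ n / (n.factorial : ℝ) * c n := by
  refine Summable.of_norm_bounded ((Real.summable_pow_div_factorial (|s| * K)).mul_left C) ?_
  intro n
  rw [Real.norm_eq_abs, abs_mul, abs_div, abs_pow, Nat.abs_cast]
  calc |s| ^ n / (n.factorial : ℝ) * |c n| ≤ |s| ^ n / (n.factorial : ℝ) * (C * K ^ n) := by
        gcongr; exact hc n
    _ = C * ((|s| * K) ^ n / (n.factorial : ℝ)) := by rw [mul_pow]; ring

/-- If `c` grows at most geometrically, then its exponential generating function is entire, and
differentiating it shifts the coefficients. -/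
theorem hasDerivAt_tsum_pow_div_factorial {c : ℕ → ℝ} {C K : ℝ}
    (hc : ∀ n, |c n| ≤ C * K ^ n) (t : ℝ) :
    HasDerivAt (fun s : ℝ => ∑' n : ℕ, s ^ n / (n.factorial : ℝ) * c n)
      (∑' n : ℕ, t ^ n / (n.factorial : ℝ) * c (n + 1)) t := by
  have hsum := summable_pow_div_factorial_mul hc
  have hsplit : (fun s : ℝ => ∑' n : ℕ, s ^ n / (n.factorial : ℝ) * c n) = fun s =>
      c 0 + ∑' n : ℕ, s ^ (n + 1) / ((n + 1).factorial : ℝ) * c (n + 1) := by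
    funext s
    rw [(hsum s).tsum_eq_zero_add]
    simp
  rw [hsplit]
  refine HasDerivAt.const_add _ ?_
  set R := |t| + 1
  have hRt : t ∈ Metric.ball (0 : ℝ) R := by simp [R]
  refine hasDerivAt_tsum_of_isPreconnected
    (g := fun (n : ℕ) (s : ℝ) => s ^ (n + 1) / ((n + 1).factorial : ℝ) * c (n + 1))
    (g' := fun (n : ℕ) (s : ℝ) => s ^ n / (n.factorial : ℝ) * c (n + 1))
    (u := fun n : ℕ => C * K * ((R * K) ^ n / (n.factorial : ℝ)))
    ((Real.summable_pow_div_factorial (R * K)).mul_left (C * K)) Metric.isOpen_ball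
    (convex_ball (0 : ℝ) R).isPreconnected ?_ ?_ hRt
    ((summable_nat_add_iff 1).2 (hsum t)) hRt
  · intro n s _
    refine (((hasDerivAt_pow (n + 1) s).div_const ((n + 1).factorial : ℝ)).mul_const
      (c (n + 1))).congr_deriv ?_
    rw [Nat.factorial_succ]
    push_cast
    field_simp
  · intro n s hs
    have hs' : |s| ≤ R := by simpa using (Metric.mem_ball.1 hs).le
    rw [Real.norm_eq_abs, abs_mul, abs_div, abs_pow, Nat.abs_cast]
    calc |s| ^ n / (n.factorial : ℝ) * |c (n + 1)|
        ≤ R ^ n / (n.factorial : ℝ) * (C * K ^ (n + 1)) := by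
          gcongr; exact hc (n + 1)
      _ = C * K * ((R * K) ^ n / (n.factorial : ℝ)) := by rw [mul_pow]; ring

/-- A sequence pinched between two positive geometric sequences has a logarithm of at most linear
growth. -/
theorem abs_log_le_of_geometric_bounds {m : ℕ → ℝ} {b a M : ℝ} (hb : 0 < b) (ha : 0 < a)
    (hlow : ∀ n, b * a ^ n ≤ m n) (hup : ∀ n, m n ≤ M ^ n) (n : ℕ) :
    |Real.log (m n)| ≤ (|Real.log b| + |Real.log a| + |Real.log M|) * (n + 1) := by
  have hlog_low : Real.log b + n * Real.log a ≤ Real.log (m n) := by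
    rw [← Real.log_pow, ← Real.log_mul hb.ne' (by positivity)]
    exact Real.log_le_log (by positivity) (hlow n)
  have hlog_up : Real.log (m n) ≤ n * Real.log M := by
    rw [← Real.log_pow]
    exact Real.log_le_log (lt_of_lt_of_le (by positivity) (hlow n)) (hup n)
  have hn : (0 : ℝ) ≤ n := n.cast_nonneg
  have h1 := mul_le_mul_of_nonneg_left (neg_abs_le (Real.log a)) hn
  have h2 := mul_le_mul_of_nonneg_left (le_abs_self (Real.log M)) hn
  have h3 := mul_nonneg hn (abs_nonneg (Real.log b))
  have h4 := mul_nonneg hn (abs_nonneg (Real.log a))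
  have h5 := mul_nonneg hn (abs_nonneg (Real.log M))
  rw [abs_le]
  constructor <;> nlinarith [neg_abs_le (Real.log b), abs_nonneg (Real.log b),
    abs_nonneg (Real.log a), abs_nonneg (Real.log M)]

theorem exists_pos_measure_le_add {A lam : ℝ} (hlam : 0 ≤ lam) {μ : Measure ℝ}
    [IsProbabilityMeasure μ] (hsupp : μ (Set.Icc 0 A)ᶜ = 0)
    (hpos : 0 < μ (Set.Ioc 0 A) ∨ 0 < lam) :
    ∃ a : ℝ, 0 < a ∧ 0 < μ (Set.Icc 0 A ∩ {x | a ≤ x + lam}) := by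
  rcases hpos with h | h
  · have hcover : Set.Ioc 0 A ⊆
        ⋃ n : ℕ, Set.Icc 0 A ∩ {x | 1 / ((n : ℝ) + 1) ≤ x + lam} := by
      intro x hx
      obtain ⟨n, hn⟩ := exists_nat_one_div_lt hx.1
      exact Set.mem_iUnion.2 ⟨n, ⟨hx.1.le, hx.2⟩, by simp only [Set.mem_ofPred_eq]; linarith⟩
    obtain ⟨n, hn⟩ := exists_measure_pos_of_not_measure_iUnion_null
      (h.trans_le (measure_mono hcover)).ne'
    exact ⟨_, by positivity, hn⟩
  · refine ⟨lam, h, ?_⟩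
    have hsub : Set.Icc 0 A ⊆ {x | lam ≤ x + lam} := by
      intro x hx
      simpa using hx.1
    rw [Set.inter_eq_left.2 hsub, (prob_compl_eq_zero_iff measurableSet_Icc).1 hsupp]
    exact one_pos

theorem mom_integrand_mem_Icc {A lam x : ℝ} (hlam : 0 ≤ lam) (hx : x ∈ Set.Icc 0 A) (y : ℕ) :
    (x + lam) ^ y * Real.exp (-(x + lam)) ∈ Set.Icc 0 ((A + lam) ^ y) := by
  have h0 : 0 ≤ x + lam := add_nonneg hx.1 hlam
  refine ⟨by positivity, ?_⟩
  calc (x + lam) ^ y * Real.exp (-(x + lam)) ≤ (A + lam) ^ y * 1 := by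
        have hA : 0 ≤ A + lam := h0.trans (by linarith [hx.2])
        have hexp : Real.exp (-(x + lam)) ≤ 1 := Real.exp_le_one_iff.2 (by linarith)
        gcongr
        exact hx.2
    _ = (A + lam) ^ y := mul_one _

theorem integrable_mom_integrand {A lam : ℝ} (hlam : 0 ≤ lam) {μ : Measure ℝ}
    [IsProbabilityMeasure μ] (hsupp : ∀ᵐ x ∂μ, x ∈ Set.Icc 0 A) (y : ℕ) :
    Integrable (fun x => (x + lam) ^ y * Real.exp (-(x + lam))) μ := by
  refine Integrable.of_mem_Icc 0 ((A + lam) ^ y) (by fun_prop) ?_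
  filter_upwards [hsupp] with x hx using mom_integrand_mem_Icc hlam hx y

theorem mom_le {A lam : ℝ} (hlam : 0 ≤ lam) {μ : Measure ℝ}
    [IsProbabilityMeasure μ] (hsupp : ∀ᵐ x ∂μ, x ∈ Set.Icc 0 A) (y : ℕ) :
    mom lam μ y ≤ (A + lam) ^ y := by
  have h := integral_mono_ae (integrable_mom_integrand hlam hsupp y)
    (integrable_const ((A + lam) ^ y))
    (by filter_upwards [hsupp] with x hx using (mom_integrand_mem_Icc hlam hx y).2)
  simpa [mom] using h

theorem exists_geometric_le_mom {A lam : ℝ} (hlam : 0 ≤ lam) {μ : Measure ℝ}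
    [IsProbabilityMeasure μ] (hsupp : μ (Set.Icc 0 A)ᶜ = 0)
    (hpos : 0 < μ (Set.Ioc 0 A) ∨ 0 < lam) :
    ∃ b a : ℝ, 0 < b ∧ 0 < a ∧ ∀ y, b * a ^ y ≤ mom lam μ y := by
  obtain ⟨a, ha, hS⟩ := exists_pos_measure_le_add hlam hsupp hpos
  set S := Set.Icc 0 A ∩ {x | a ≤ x + lam}
  have hSm : MeasurableSet S :=
    measurableSet_Icc.inter (measurableSet_le measurable_const (by fun_prop))
  have hae : ∀ᵐ x ∂μ, x ∈ Set.Icc 0 A := by rwa [ae_iff]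
  refine ⟨μ.real S * Real.exp (-(A + lam)), a,
    mul_pos (ENNReal.toReal_pos hS.ne' (measure_ne_top _ _)) (Real.exp_pos _), ha, fun y => ?_⟩
  have hint := integrable_mom_integrand hlam hae y
  calc μ.real S * Real.exp (-(A + lam)) * a ^ y
      = ∫ _ in S, a ^ y * Real.exp (-(A + lam)) ∂μ := by
        rw [setIntegral_const, smul_eq_mul]; ring
    _ ≤ ∫ x in S, (x + lam) ^ y * Real.exp (-(x + lam)) ∂μ := by
        refine setIntegral_mono_on (integrable_const _) hint.integrableOn hSm fun x hx => ?_
        have hax : a ≤ x + lam := hx.2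
        have hxA : x ≤ A := hx.1.2
        have h0 : 0 ≤ x + lam := ha.le.trans hax
        gcongr
    _ ≤ mom lam μ y := by
        refine setIntegral_le_integral hint ?_
        filter_upwards [hae] with x hx using (mom_integrand_mem_Icc hlam hx y).1

/-- First derivative identity for `G`. -/
theorem GFun_hasDerivAt (A lam : ℝ) (hA : 0 < A) (hlam : 0 ≤ lam)
    (μ : Measure ℝ) [IsProbabilityMeasure μ] (hsupp : μ (Set.Icc 0 A)ᶜ = 0)
    (hpos : 0 < μ (Set.Ioc 0 A) ∨ 0 < lam)
    (x : ℝ) (hx : 0 < x) :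
    HasDerivAt (GFun lam μ)
      (∑' y : ℕ, channelPMF lam x y * Real.log (mom lam μ y / mom lam μ (y + 1))) x := by
  have hae : ∀ᵐ x ∂μ, x ∈ Set.Icc 0 A := by rwa [ae_iff]
  obtain ⟨b, a, hb, ha, hlow⟩ := exists_geometric_le_mom hlam hsupp hpos
  have hmom (y : ℕ) : 0 < mom lam μ y := lt_of_lt_of_le (by positivity) (hlow y)
  set c : ℕ → ℝ := fun y => -Real.log (mom lam μ y)
  obtain ⟨C, hc⟩ : ∃ C : ℝ, ∀ y, |c y| ≤ C * 2 ^ y := by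
    refine ⟨|Real.log b| + |Real.log a| + |Real.log (A + lam)|, fun y => ?_⟩
    have hy : (y : ℝ) + 1 ≤ 2 ^ y := mod_cast Nat.succ_le_of_lt y.lt_two_pow_self
    rw [abs_neg]
    refine (abs_log_le_of_geometric_bounds hb ha hlow (mom_le hlam hae) y).trans ?_
    gcongr
  have hG : GFun lam μ = fun s =>
      Real.exp (-(s + lam)) * ∑' y : ℕ, (s + lam) ^ y / (y.factorial : ℝ) * c y := by
    funext s
    rw [GFun, ← tsum_mul_left]
    refine tsum_congr fun y => ?_
    rw [mul_div_cancel₀ _ (by positivity : (y.factorial : ℝ) ≠ 0), one_div, Real.log_inv,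
      channelPMF]
    ring
  have hsum {d : ℕ → ℝ} {D : ℝ} (hd : ∀ y, |d y| ≤ D * 2 ^ y) :
      Summable fun y : ℕ => (x + lam) ^ y / (y.factorial : ℝ) * d y :=
    summable_pow_div_factorial_mul hd (x + lam)
  have hc' (y : ℕ) : |c (y + 1)| ≤ C * 2 * 2 ^ y := by
    simpa [pow_succ', mul_assoc] using hc (y + 1)
  have hexp : HasDerivAt (fun s => Real.exp (-(s + lam))) (-Real.exp (-(x + lam))) x := by
    simpa using (hasDerivAt_neg (x + lam)).exp.comp_add_const x lam
  have hseries := (hasDerivAt_tsum_pow_div_factorial hc (x + lam)).comp_add_const x lam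
  rw [hG]
  refine (hexp.mul hseries).congr_deriv ?_
  calc _ = Real.exp (-(x + lam)) * ((∑' y : ℕ, (x + lam) ^ y / (y.factorial : ℝ) * c (y + 1))
          - ∑' y : ℕ, (x + lam) ^ y / (y.factorial : ℝ) * c y) := by ring
    _ = ∑' y : ℕ, Real.exp (-(x + lam)) * ((x + lam) ^ y / (y.factorial : ℝ) * c (y + 1)
          - (x + lam) ^ y / (y.factorial : ℝ) * c y) := by
        rw [tsum_mul_left, (hsum hc').tsum_sub (hsum hc)]
    _ = _ := by
        refine tsum_congr fun y => ?_
        rw [Real.log_div (hmom y).ne' (hmom (y + 1)).ne', channelPMF]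
        ring
end
end
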